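/- Let A : ℝ^m → M_m(ℝ) be a C¹ field of symmetric matrices. Then the following three statements are equivalent: (1) [b,A] := (b·∇_y)A − (∂_yb) A − A ᵗ(∂_yb) vanishes identically on ℝ^m; (2) for every s ∈ ℝ and all u, v ∈ C¹_c(ℝ^m), ∫_{ℝ^m} A(y) ∇_y(u∘Y(s;·)) · ∇_y(v∘Y(s;·)) dy = ∫_{ℝ^m} A(y) ∇_y u · ∇_y v dy; (3) for all u, v ∈ C²_c(ℝ^m), ∫_{ℝ^m} A ∇_y(b·∇_y u) · ∇_y v dy + ∫_{ℝ^m} A ∇_y u · ∇_y(b·∇_y v) dy = 0. -/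

import Mathlib

open MeasureTheory Matrix

section ODE
variable {E : Type*} [NormedAddCommGroup E] [NormedSpace ℝ E] [FiniteDimensional ℝ E]

theorem aux_lip_ball {b : E → E} (hb : ContDiff ℝ 1 b) (R : ℝ) :
    ∃ K : NNReal, LipschitzOnWith K b (Metric.closedBall 0 R) := by
  have : ProperSpace E := FiniteDimensional.proper ℝ E
  exact LocallyLipschitzOn.exists_lipschitzOnWith_of_compact
    (isCompact_closedBall 0 R) (hb.locallyLipschitz.locallyLipschitzOn)

theorem aux_bound_pos {b : E → E} {C : ℝ} (hC : 0 < C) (hgrow : ∀ y, ‖b y‖ ≤ C * (1 + ‖y‖))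
    {Y : ℝ → E → E} (hY0 : ∀ y, Y 0 y = y)
    (hYd : ∀ (s : ℝ) (y : E), HasDerivAt (fun t => Y t y) (b (Y s y)) s) (T r : ℝ) :
    ∃ R, ∀ y, ‖y‖ ≤ r → ∀ t ∈ Set.Icc 0 T, ‖Y t y‖ ≤ R := by
  refine ⟨gronwallBound r C C T, fun y hy t ht => ?_⟩
  have hr : 0 ≤ r := (norm_nonneg y).trans hy
  have h := norm_le_gronwallBound_of_norm_deriv_right_le (f := fun t => Y t y)
    (f' := fun t => b (Y t y)) (δ := r) (K := C) (ε := C) (a := 0) (b := T)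
    (fun s _ => (hYd s y).continuousAt.continuousWithinAt)
    (fun s _ => (hYd s y).hasDerivWithinAt) (by simpa [hY0] using hy)
    (fun s _ => by have := hgrow (Y s y); linarith) t ht
  refine h.trans (gronwallBound_mono hr hC.le hC.le (by linarith [ht.2]))

theorem aux_lip_pos {b : E → E} (hb : ContDiff ℝ 1 b) {C : ℝ} (hC : 0 < C)
    (hgrow : ∀ y, ‖b y‖ ≤ C * (1 + ‖y‖))
    {Y : ℝ → E → E} (hY0 : ∀ y, Y 0 y = y)
    (hYd : ∀ (s : ℝ) (y : E), HasDerivAt (fun t => Y t y) (b (Y s y)) s) (T r : ℝ) :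
    ∃ K, ∀ y y', ‖y‖ ≤ r → ‖y'‖ ≤ r → ∀ t ∈ Set.Icc 0 T, ‖Y t y - Y t y'‖ ≤ K * ‖y - y'‖ := by
  obtain ⟨R, hR⟩ := aux_bound_pos hC hgrow hY0 hYd T r
  obtain ⟨K, hK⟩ := aux_lip_ball hb R
  refine ⟨Real.exp (K * T), fun y y' hy hy' t ht => ?_⟩
  have h := dist_le_of_trajectories_ODE_of_mem (v := fun _ => b) (s := fun _ => Metric.closedBall 0 R)
    (K := K) (f := fun t => Y t y) (g := fun t => Y t y') (a := 0) (b := T) (δ := ‖y - y'‖)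
    (fun _ _ => hK)
    (fun s _ => (hYd s y).continuousAt.continuousWithinAt)
    (fun s _ => (hYd s y).hasDerivWithinAt)
    (fun s hs => by simpa using hR y hy s ⟨hs.1, hs.2.le⟩)
    (fun s _ => (hYd s y').continuousAt.continuousWithinAt)
    (fun s _ => (hYd s y').hasDerivWithinAt)
    (fun s hs => by simpa using hR y' hy' s ⟨hs.1, hs.2.le⟩)
    (by simp [hY0, dist_eq_norm]) t ht
  rw [dist_eq_norm] at h
  refine h.trans ?_
  rw [mul_comm]
  gcongr
  linarith [ht.2]

theorem aux_lip {b : E → E} (hb : ContDiff ℝ 1 b) {C : ℝ} (hC : 0 < C)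
    (hgrow : ∀ y, ‖b y‖ ≤ C * (1 + ‖y‖))
    {Y : ℝ → E → E} (hY0 : ∀ y, Y 0 y = y)
    (hYd : ∀ (s : ℝ) (y : E), HasDerivAt (fun t => Y t y) (b (Y s y)) s) (T r : ℝ) :
    ∃ R K, 0 ≤ K ∧ ∀ y y', ‖y‖ ≤ r → ‖y'‖ ≤ r → ∀ t, |t| ≤ T →
      ‖Y t y‖ ≤ R ∧ ‖Y t y - Y t y'‖ ≤ K * ‖y - y'‖ := by
  have hYd' : ∀ (s : ℝ) (y : E), HasDerivAt (fun t => Y (-t) y) ((fun z => - b z) (Y (-s) y)) s := by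
    intro s y
    have := (hYd (-s) y).scomp s (hasDerivAt_neg s)
    simpa [Function.comp_def] using this
  have hY0' : ∀ y, Y (-0) y = y := by simpa using hY0
  obtain ⟨R1, h1⟩ := aux_bound_pos hC hgrow hY0 hYd T r
  obtain ⟨R2, h2⟩ := aux_bound_pos (Y := fun t => Y (-t)) (b := fun z => - b z) hC
    (by simpa using hgrow) hY0' hYd' T r
  obtain ⟨K1, h3⟩ := aux_lip_pos hb hC hgrow hY0 hYd T r
  obtain ⟨K2, h4⟩ := aux_lip_pos (Y := fun t => Y (-t)) (b := fun z => - b z) hb.neg hC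
    (by simpa using hgrow) hY0' hYd' T r
  refine ⟨max R1 R2, max (max K1 K2) 0, le_max_right _ _, fun y y' hy hy' t ht => ?_⟩
  rw [abs_le] at ht
  rcases le_total 0 t with h | h
  · exact ⟨(h1 y hy t ⟨h, ht.2⟩).trans (le_max_left _ _), (h3 y y' hy hy' t ⟨h, ht.2⟩).trans
      (by gcongr; simp)⟩
  · have e := h2 y hy (-t) ⟨by linarith, by linarith⟩
    have e' := h4 y y' hy hy' (-t) ⟨by linarith, by linarith⟩
    simp only [neg_neg] at e e'
    exact ⟨e.trans (le_max_right _ _), e'.trans (by gcongr; simp)⟩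

theorem aux_zero {F : Type*} [NormedAddCommGroup F] [NormedSpace ℝ F] {f f' : ℝ → F}
    (hf : ∀ t, HasDerivAt f (f' t) t) (h0 : f 0 = 0)
    (hK : ∀ T : ℝ, ∃ K, ∀ t, |t| ≤ T → ‖f' t‖ ≤ K * ‖f t‖) (t : ℝ) : f t = 0 := by
  obtain ⟨K, hK⟩ := hK |t|
  rcases le_total 0 t with h | h
  · refine eq_zero_of_abs_deriv_le_mul_abs_self_of_eq_zero_right (f := f) (f' := f') (K := K)
      (a := 0) (b := t) (fun s _ => (hf s).continuousAt.continuousWithinAt)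
      (fun s _ => (hf s).hasDerivWithinAt) h0 (fun s hs => hK s ?_) t ⟨h, le_rfl⟩
    rw [abs_of_nonneg hs.1, abs_of_nonneg h]; exact hs.2.le
  · have hf2 : ∀ s, HasDerivAt (fun s => f (-s)) (- f' (-s)) s := by
      intro s
      have := (hf (-s)).scomp s (hasDerivAt_neg s)
      simpa [Function.comp_def] using this
    have := eq_zero_of_abs_deriv_le_mul_abs_self_of_eq_zero_right (f := fun s => f (-s))
      (f' := fun s => - f' (-s)) (K := K)
      (a := 0) (b := -t) (fun s _ => (hf2 s).continuousAt.continuousWithinAt)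
      (fun s _ => (hf2 s).hasDerivWithinAt) (by simpa using h0)
      (fun s hs => by
        rw [norm_neg]; apply hK
        rw [abs_neg, abs_of_nonneg hs.1, abs_of_nonpos h]; exact hs.2.le) (-t) ⟨by linarith, le_rfl⟩
    simpa using this

theorem aux_unique {b : E → E} (hb : ContDiff ℝ 1 b) {f g : ℝ → E}
    (hf : ∀ t, HasDerivAt f (b (f t)) t) (hg : ∀ t, HasDerivAt g (b (g t)) t) (h0 : f 0 = g 0)
    (t : ℝ) : f t = g t := by
  rw [← sub_eq_zero]
  refine aux_zero (f := fun t => f t - g t) (f' := fun t => b (f t) - b (g t))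
    (fun t => (hf t).sub (hg t)) (by simp [h0]) (fun T => ?_) t
  have hfc : Continuous f := continuous_iff_continuousAt.2 fun t => (hf t).continuousAt
  have hgc : Continuous g := continuous_iff_continuousAt.2 fun t => (hg t).continuousAt
  obtain ⟨R1, h1⟩ := (isCompact_Icc (a := -T) (b := T)).exists_bound_of_continuousOn hfc.continuousOn
  obtain ⟨R2, h2⟩ := (isCompact_Icc (a := -T) (b := T)).exists_bound_of_continuousOn hgc.continuousOn
  obtain ⟨K, hK⟩ := aux_lip_ball hb (max R1 R2)
  refine ⟨K, fun t ht => ?_⟩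
  have := hK.dist_le_mul (f t) (by simpa using Or.inl (h1 t (abs_le.1 ht))) (g t)
    (by simpa using Or.inr (h2 t (abs_le.1 ht)))
  simpa [dist_eq_norm] using this

theorem aux_inv {b : E → E} (hb : ContDiff ℝ 1 b)
    {Y : ℝ → E → E} (hY0 : ∀ y, Y 0 y = y)
    (hYd : ∀ (s : ℝ) (y : E), HasDerivAt (fun t => Y t y) (b (Y s y)) s) (s : ℝ) (y : E) :
    Y (-s) (Y s y) = y := by
  have := aux_unique hb (f := fun t => Y t (Y s y)) (g := fun t => Y (t + s) y)
    (fun t => hYd t _) (fun t => (hYd (t+s) y).comp_add_const t s) (by simp [hY0]) (-s)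
  simpa [hY0] using this

theorem aux_var {b : E → E} (hb : ContDiff ℝ 1 b) {C : ℝ} (hC : 0 < C)
    (hgrow : ∀ y, ‖b y‖ ≤ C * (1 + ‖y‖))
    {Y : ℝ → E → E} (hY0 : ∀ y, Y 0 y = y)
    (hYd : ∀ (s : ℝ) (y : E), HasDerivAt (fun t => Y t y) (b (Y s y)) s)
    (hYs : ∀ s : ℝ, ContDiff ℝ 1 (Y s)) (y v : E) (s : ℝ) :
    HasDerivAt (fun t => fderiv ℝ (Y t) y v) (fderiv ℝ b (Y s y) (fderiv ℝ (Y s) y v)) s := by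
  have : CompleteSpace E := FiniteDimensional.complete ℝ E
  borelize E
  have hYc : ∀ z, Continuous fun t => Y t z := fun z =>
    continuous_iff_continuousAt.2 fun t => (hYd t z).continuousAt
  have hline : ∀ t, HasDerivAt (fun h : ℝ => Y t (y + h • v)) (fderiv ℝ (Y t) y v) 0 := by
    intro t
    have h1 : HasFDerivAt (Y t) (fderiv ℝ (Y t) y) (y + (0:ℝ) • v) := by
      simpa using ((hYs t).differentiable (by norm_num) y).hasFDerivAt
    have h2 : HasDerivAt (fun h : ℝ => y + h • v) v 0 := by
      simpa using ((hasDerivAt_id (0:ℝ)).smul_const v).const_add y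
    exact h1.comp_hasDerivAt (0:ℝ) h2
  have hmeas : StronglyMeasurable fun t => fderiv ℝ (Y t) y v := by
    refine stronglyMeasurable_of_tendsto (f := fun n : ℕ => fun t =>
      ((1:ℝ)/(n+1))⁻¹ • (Y t (y + ((1:ℝ)/(n+1)) • v) - Y t y)) Filter.atTop
      (fun n => Continuous.stronglyMeasurable (((hYc _).sub (hYc _)).const_smul _)) ?_
    rw [tendsto_pi_nhds]
    intro t
    have h1 := (hasDerivAt_iff_tendsto_slope_zero.1 (hline t))
    have h2 : Filter.Tendsto (fun n : ℕ => (1:ℝ)/(n+1)) Filter.atTop (nhdsWithin 0 {0}ᶜ) := by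
      refine tendsto_nhdsWithin_iff.2 ⟨tendsto_one_div_add_atTop_nhds_zero_nat, ?_⟩
      filter_upwards with n
      simp only [Set.mem_compl_iff, Set.mem_singleton_iff]
      positivity
    have := h1.comp h2
    simpa [Function.comp_def] using this
  have hDb : Continuous (fderiv ℝ b) := hb.continuous_fderiv (by norm_num)
  set g : ℝ → E := fun t => fderiv ℝ b (Y t y) (fderiv ℝ (Y t) y v) with hg
  have hgm : StronglyMeasurable g := by
    exact (ContinuousLinearMap.apply ℝ E).flip.isBoundedBilinearMap.continuous.comp_stronglyMeasurable
       ((hDb.comp (hYc y)).stronglyMeasurable.prodMk hmeas)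
  have key : ∀ s, IntervalIntegrable g volume 0 s ∧ fderiv ℝ (Y s) y v = v + ∫ t in (0:ℝ)..s, g t := by
    intro s
    obtain ⟨R, K, hK0, hRK⟩ := aux_lip hb hC hgrow hY0 hYd |s| (‖y‖ + ‖v‖)
    obtain ⟨L, hL⟩ := aux_lip_ball hb R
    have hn : ∀ h ∈ Metric.ball (0:ℝ) 1, ‖y + h • v‖ ≤ ‖y‖ + ‖v‖ := by
      intro h hh
      refine (norm_add_le _ _).trans ?_
      rw [norm_smul]
      have : ‖h‖ < 1 := by simpa using hh
      nlinarith [norm_nonneg v]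
    have hint := intervalIntegral.hasDerivAt_integral_of_dominated_loc_of_lip (μ := volume)
      (a := 0) (b := s)
      (F := fun h t => b (Y t (y + h • v))) (F' := g) (x₀ := (0:ℝ)) (s := Metric.ball 0 1)
      (bound := fun _ => L * (K * ‖v‖))
      (Metric.ball_mem_nhds _ one_pos)
      (Filter.Eventually.of_forall fun h =>
        (hb.continuous.comp (hYc _)).aestronglyMeasurable)
      ((hb.continuous.comp (hYc _)).intervalIntegrable _ _)
      hgm.aestronglyMeasurable
      (Filter.Eventually.of_forall fun t ht => by
        have ht' : |t| ≤ |s| := by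
          have := Set.uIoc_subset_uIcc ht
          rw [Set.mem_uIcc] at this
          rcases this with h | h
          · rw [abs_of_nonneg h.1, abs_of_nonneg (h.1.trans h.2)]; exact h.2
          · rw [abs_of_nonpos h.2, abs_of_nonpos (h.1.trans h.2)]; linarith
        refine LipschitzOnWith.of_dist_le_mul fun h1 hh1 h2 hh2 => ?_
        have e1 := hRK _ _ (hn h1 hh1) (hn h2 hh2) t ht'
        have e2 := hRK _ _ (hn h2 hh2) (hn h1 hh1) t ht'
        have e3 := hL.dist_le_mul (Y t (y + h1 • v)) (by simpa using e1.1) (Y t (y + h2 • v))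
          (by simpa using e2.1)
        have e4 : ‖(y + h1 • v) - (y + h2 • v)‖ = ‖v‖ * |h1 - h2| := by
          rw [add_sub_add_left_eq_sub, ← sub_smul, norm_smul, mul_comm]; rfl
        rw [dist_eq_norm (Y t _)] at e3
        rw [e4] at e1
        have e5 : ((Real.nnabs (L * (K * ‖v‖)) : NNReal) : ℝ) = L * (K * ‖v‖) := by
          rw [Real.coe_nnabs, abs_of_nonneg (by positivity)]
        rw [e5, Real.dist_eq]
        refine e3.trans ?_
        calc (L:ℝ) * _ ≤ L * (K * (‖v‖ * |h1 - h2|)) := by gcongr; exact e1.2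
          _ = _ := by ring)
      intervalIntegrable_const
      (Filter.Eventually.of_forall fun t _ => by
        have h1 : HasFDerivAt b (fderiv ℝ b (Y t y)) (Y t (y + (0:ℝ) • v)) := by
          simpa using (hb.differentiable (by norm_num) (Y t y)).hasFDerivAt
        exact h1.comp_hasDerivAt (0:ℝ) (hline t))
    refine ⟨hint.1, ?_⟩
    have h2 : HasDerivAt (fun h : ℝ => y + h • v) v 0 := by
      simpa using ((hasDerivAt_id (0:ℝ)).smul_const v).const_add y
    refine (hline s).unique ?_
    refine (h2.add hint.2).congr_of_eventuallyEq (Filter.Eventually.of_forall fun h => ?_)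
    have := intervalIntegral.integral_eq_sub_of_hasDerivAt (a := 0) (b := s)
      (f := fun t => Y t (y + h • v))
      (fun t _ => hYd t (y + h • v)) ((hb.continuous.comp (hYc _)).intervalIntegrable _ _)
    simp only [hY0] at this
    simp [this]
  have hint : ∀ a c, IntervalIntegrable g volume a c := fun a c =>
    (key a).1.symm.trans (key c).1
  have hDc : Continuous fun t => fderiv ℝ (Y t) y v := by
    have : (fun t => fderiv ℝ (Y t) y v) = fun s => v + ∫ t in (0:ℝ)..s, g t := by
      ext1 s; exact (key s).2
    rw [this]
    exact continuous_const.add (intervalIntegral.continuous_primitive hint 0)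
  have hgc : Continuous g := (hDb.comp (hYc y)).clm_apply hDc
  have := (intervalIntegral.integral_hasDerivAt_right (hint 0 s)
    (hgc.stronglyMeasurableAtFilter _ _) hgc.continuousAt).const_add v
  refine this.congr_of_eventuallyEq (Filter.Eventually.of_forall fun t => (key t).2)

end ODE

section Test
variable {m : ℕ}

noncomputable def gradv (u : (Fin m → ℝ) → ℝ) (y : Fin m → ℝ) : Fin m → ℝ :=
  fun i => fderiv ℝ u y (Pi.single i (1:ℝ))

noncomputable def jacm (F : (Fin m → ℝ) → (Fin m → ℝ)) (y : Fin m → ℝ) : Matrix (Fin m) (Fin m) ℝ :=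
  Matrix.of fun i j => fderiv ℝ (fun z => F z i) y (Pi.single j (1:ℝ))

theorem fderiv_eq_gradv (u : (Fin m → ℝ) → ℝ) (y x : Fin m → ℝ) :
    fderiv ℝ u y x = gradv u y ⬝ᵥ x := by
  conv_lhs => rw [pi_eq_sum_univ' x]
  rw [map_sum]
  simp only [dotProduct, gradv, map_smul, smul_eq_mul]
  refine Finset.sum_congr rfl fun i _ => ?_
  rw [mul_comm]

theorem jacm_apply {F : (Fin m → ℝ) → (Fin m → ℝ)} {y : Fin m → ℝ} (hF : DifferentiableAt ℝ F y)
    (i j : Fin m) : jacm F y i j = fderiv ℝ F y (Pi.single j 1) i := by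
  simp only [jacm, Matrix.of_apply]
  have h := (hasFDerivAt_pi'.1 hF.hasFDerivAt) i
  rw [h.fderiv]; rfl

theorem gradv_comp {F : (Fin m → ℝ) → (Fin m → ℝ)} {u : (Fin m → ℝ) → ℝ} {y : Fin m → ℝ}
    (hu : DifferentiableAt ℝ u (F y)) (hF : DifferentiableAt ℝ F y) :
    gradv (fun z => u (F z)) y = (jacm F y)ᵀ *ᵥ gradv u (F y) := by
  ext i
  have h := hu.hasFDerivAt.comp y hF.hasFDerivAt
  have h2 : fderiv ℝ (fun z => u (F z)) y = _ := h.fderiv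
  rw [gradv, h2, ContinuousLinearMap.comp_apply, fderiv_eq_gradv, dotProduct_comm]
  simp [Matrix.mulVec, dotProduct, jacm_apply hF]

theorem contDiff_gradv {n : ℕ} {u : (Fin m → ℝ) → ℝ} (hu : ContDiff ℝ (n+1) u) (i : Fin m) :
    ContDiff ℝ n (fun y => gradv u y i) :=
  (hu.fderiv_right (m := n) le_rfl).clm_apply contDiff_const

theorem continuous_gradv {u : (Fin m → ℝ) → ℝ} (hu : ContDiff ℝ 1 u) : Continuous (gradv u) :=
  continuous_pi fun _ => (hu.continuous_fderiv (by norm_num)).clm_apply continuous_const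

theorem hcs_form {v : (Fin m → ℝ) → ℝ} (hv : HasCompactSupport v) (p : (Fin m → ℝ) → (Fin m → ℝ)) :
    HasCompactSupport (fun y => p y ⬝ᵥ gradv v y) := by
  refine (hv.fderiv ℝ).mono ?_
  intro y hy
  contrapose! hy
  have : fderiv ℝ v y = 0 := by simpa using hy
  have h2 : gradv v y = 0 := by ext i; simp [gradv, this]
  simp [h2]

theorem int_form {B : (Fin m → ℝ) → Matrix (Fin m) (Fin m) ℝ} (hB : Continuous B)
    {p : (Fin m → ℝ) → (Fin m → ℝ)} (hp : Continuous p)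
    {v : (Fin m → ℝ) → ℝ} (hv : ContDiff ℝ 1 v) (hvs : HasCompactSupport v) :
    Integrable (fun y => (B y *ᵥ p y) ⬝ᵥ gradv v y) := by
  refine Continuous.integrable_of_hasCompactSupport ?_ (hcs_form hvs _)
  exact (hB.matrix_mulVec hp).dotProduct (continuous_gradv hv)

theorem form_comm {B : Matrix (Fin m) (Fin m) ℝ} (hB : Bᵀ = B) (x y : Fin m → ℝ) :
    (B *ᵥ x) ⬝ᵥ y = (B *ᵥ y) ⬝ᵥ x := by
  rw [dotProduct_comm, dotProduct_mulVec, ← mulVec_transpose, hB]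

theorem int_form' {B : (Fin m → ℝ) → Matrix (Fin m) (Fin m) ℝ} (hB : Continuous B)
    (hBs : ∀ y, (B y)ᵀ = B y)
    {p : (Fin m → ℝ) → (Fin m → ℝ)} (hp : Continuous p)
    {v : (Fin m → ℝ) → ℝ} (hv : ContDiff ℝ 1 v) (hvs : HasCompactSupport v) :
    Integrable (fun y => (B y *ᵥ gradv v y) ⬝ᵥ p y) := by
  simp_rw [fun y => form_comm (hBs y) (gradv v y) (p y)]
  exact int_form hB hp hv hvs

theorem nonpos_of_sq {f : (Fin m → ℝ) → ℝ} (hf : Continuous f)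
    (h : ∀ φ : (Fin m → ℝ) → ℝ, ContDiff ℝ 2 φ → HasCompactSupport φ → ∫ y, φ y ^ 2 * f y = 0)
    (y : Fin m → ℝ) : f y ≤ 0 := by
  by_contra! hpos
  obtain ⟨ε, hε, hball⟩ := Metric.mem_nhds_iff.1 (hf.continuousAt.eventually (lt_mem_nhds hpos))
  let φ : ContDiffBump y := ⟨ε/2, ε, by positivity, by linarith⟩
  have h0 := h φ φ.contDiff φ.hasCompactSupport
  have hnn : 0 ≤ fun z => φ z ^ 2 * f z := by
    intro z
    by_cases hz : z ∈ Metric.ball y ε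
    · have : 0 < f z := hball hz
      simp only [Pi.zero_apply]; positivity
    · have : φ z = 0 := φ.zero_of_le_dist (by simpa using hz)
      simp [this]
  have hcs : HasCompactSupport fun z => φ z ^ 2 * f z := by
    refine φ.hasCompactSupport.mono ?_
    intro z hz
    contrapose! hz
    have : φ z = 0 := by simpa using hz
    simp [this]
  have := Continuous.integral_pos_of_hasCompactSupport_nonneg_nonzero (μ := volume)
    ((φ.continuous.pow 2).mul hf) hcs hnn (x := y) (by
      have : φ y = 1 := φ.one_of_mem_closedBall (by simp [φ.rIn_pos.le])
      simp [this, hpos.ne'])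
  exact this.ne' h0

theorem zero_of_sq {f : (Fin m → ℝ) → ℝ} (hf : Continuous f)
    (h : ∀ φ : (Fin m → ℝ) → ℝ, ContDiff ℝ 2 φ → HasCompactSupport φ → ∫ y, φ y ^ 2 * f y = 0)
    (y : Fin m → ℝ) : f y = 0 := by
  refine le_antisymm (nonpos_of_sq hf h y) ?_
  have := nonpos_of_sq (f := fun z => - f z) hf.neg (fun φ h1 h2 => by
    simp only [mul_neg, integral_neg, h φ h1 h2, neg_zero]) y
  linarith

theorem zero_of_forms {B : (Fin m → ℝ) → Matrix (Fin m) (Fin m) ℝ} (hB : Continuous B)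
    (hBs : ∀ y, (B y)ᵀ = B y)
    (h : ∀ u v : (Fin m → ℝ) → ℝ, ContDiff ℝ 2 u → HasCompactSupport u → ContDiff ℝ 2 v →
      HasCompactSupport v → ∫ y, (B y *ᵥ gradv u y) ⬝ᵥ gradv v y = 0) (y : Fin m → ℝ) : B y = 0 := by
  have key : ∀ ξ : Fin m → ℝ, ∀ y, (B y *ᵥ ξ) ⬝ᵥ ξ = 0 := by
    intro ξ
    refine zero_of_sq ((hB.matrix_mulVec continuous_const).dotProduct continuous_const) ?_
    intro φ hφ hφs
    let l : (Fin m → ℝ) → ℝ := fun z => ξ ⬝ᵥ z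
    have hl : ContDiff ℝ 2 l := by
      simp only [l, dotProduct]
      fun_prop
    have hld : ∀ z, gradv l z = ξ := by
      intro z
      ext i
      have : HasFDerivAt l (∑ k, ξ k • (ContinuousLinearMap.proj k : (Fin m → ℝ) →L[ℝ] ℝ)) z := by
        simp only [l, dotProduct]
        refine HasFDerivAt.fun_sum fun k _ => ?_
        exact ((ContinuousLinearMap.proj k : (Fin m → ℝ) →L[ℝ] ℝ).hasFDerivAt).const_mul (ξ k)
      simp [gradv, this.fderiv, Pi.single_apply]
    have c1 : ContDiff ℝ 2 fun z => φ z * Real.cos (l z) := hφ.mul hl.cos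
    have c2 : ContDiff ℝ 2 fun z => φ z * Real.sin (l z) := hφ.mul hl.sin
    have s1 : HasCompactSupport fun z => φ z * Real.cos (l z) := hφs.mul_right
    have s2 : HasCompactSupport fun z => φ z * Real.sin (l z) := hφs.mul_right
    have dl : ∀ z, HasFDerivAt l (fderiv ℝ l z) z := fun z =>
      (hl.differentiable (by norm_num) z).hasFDerivAt
    have dφ : ∀ z, HasFDerivAt φ (fderiv ℝ φ z) z := fun z =>
      (hφ.differentiable (by norm_num) z).hasFDerivAt
    have g1 : ∀ z, gradv (fun z => φ z * Real.cos (l z)) z =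
        Real.cos (l z) • gradv φ z - (φ z * Real.sin (l z)) • ξ := by
      intro z
      have := ((dφ z).mul (dl z).cos).fderiv
      conv_rhs => rw [← hld z]
      ext i
      simp only [gradv, Pi.add_apply, Pi.sub_apply, Pi.smul_apply]
      erw [this]
      simp; ring
    have g2 : ∀ z, gradv (fun z => φ z * Real.sin (l z)) z =
        Real.sin (l z) • gradv φ z + (φ z * Real.cos (l z)) • ξ := by
      intro z
      have := ((dφ z).mul (dl z).sin).fderiv
      conv_rhs => rw [← hld z]
      ext i
      simp only [gradv, Pi.add_apply, Pi.sub_apply, Pi.smul_apply]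
      erw [this]
      simp; ring
    have one_two : (1 : WithTop ℕ∞) ≤ 2 := by norm_num
    have i1 := int_form hB (continuous_gradv (c1.of_le one_two)) (c1.of_le one_two) s1
    have i2 := int_form hB (continuous_gradv (c2.of_le one_two)) (c2.of_le one_two) s2
    have i3 := int_form hB (continuous_gradv (hφ.of_le one_two)) (hφ.of_le one_two) hφs
    have e : ∀ z, φ z ^ 2 * ((B z *ᵥ ξ) ⬝ᵥ ξ) =
      (B z *ᵥ gradv (fun z => φ z * Real.cos (l z)) z) ⬝ᵥ gradv (fun z => φ z * Real.cos (l z)) z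
      + (B z *ᵥ gradv (fun z => φ z * Real.sin (l z)) z) ⬝ᵥ gradv (fun z => φ z * Real.sin (l z)) z
      - (B z *ᵥ gradv φ z) ⬝ᵥ gradv φ z := by
      intro z
      rw [g1, g2]
      simp only [mulVec_sub, mulVec_add, mulVec_smul, sub_dotProduct, dotProduct_sub,
        add_dotProduct, dotProduct_add, smul_dotProduct, dotProduct_smul, smul_eq_mul]
      have := Real.sin_sq_add_cos_sq (l z)
      linear_combination (- φ z ^ 2 * ((B z *ᵥ ξ) ⬝ᵥ ξ) - (B z *ᵥ gradv φ z) ⬝ᵥ gradv φ z) * this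
    simp_rw [e]
    have i12 : Integrable (fun z =>
      (B z *ᵥ gradv (fun z => φ z * Real.cos (l z)) z) ⬝ᵥ gradv (fun z => φ z * Real.cos (l z)) z
      + (B z *ᵥ gradv (fun z => φ z * Real.sin (l z)) z) ⬝ᵥ gradv (fun z => φ z * Real.sin (l z)) z) :=
      i1.add i2
    rw [integral_sub i12 i3, integral_add i1 i2, h _ _ c1 s1 c1 s1, h _ _ c2 s2 c2 s2,
      h _ _ hφ hφs hφ hφs]
    simp
  ext i j
  have k1 := key (Pi.single i 1) y
  have k2 := key (Pi.single j 1) y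
  have k3 := key (Pi.single i 1 + Pi.single j 1) y
  have hs : B y i j = B y j i := congrFun (congrFun (hBs y) j) i
  simp [mulVec_add, add_dotProduct, dotProduct_add] at k1 k2 k3
  simp only [Matrix.zero_apply]
  linarith

theorem integral_transport {b : (Fin m → ℝ) → (Fin m → ℝ)} (hb : ContDiff ℝ 1 b)
    (hdivb : ∀ y, ∑ i, fderiv ℝ (fun z => b z i) y (Pi.single i (1:ℝ)) = 0)
    {w : (Fin m → ℝ) → ℝ} (hw : ContDiff ℝ 1 w) (hws : HasCompactSupport w) :
    ∫ y, fderiv ℝ w y (b y) = 0 := by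
  have hbi : ∀ i, ContDiff ℝ 1 fun z => b z i := fun i => contDiff_pi.1 hb i
  have hD : ∀ i, Continuous fun y => fderiv ℝ (fun z => b z i) y (Pi.single i (1:ℝ)) := fun i =>
    ((hbi i).continuous_fderiv (by norm_num)).clm_apply continuous_const
  have hDw : ∀ i, Continuous fun y => fderiv ℝ w y (Pi.single i (1:ℝ)) := fun i =>
    (hw.continuous_fderiv (by norm_num)).clm_apply continuous_const
  have hcsw : ∀ i : Fin m, HasCompactSupport fun y => fderiv ℝ w y (Pi.single i (1:ℝ)) := fun i =>
    hws.fderiv_apply ℝ _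
  have I1 : ∀ i, Integrable fun y => fderiv ℝ (fun z => b z i) y (Pi.single i (1:ℝ)) * w y := fun i =>
    ((hD i).mul hw.continuous).integrable_of_hasCompactSupport hws.mul_left
  have I2 : ∀ i, Integrable fun y => b y i * fderiv ℝ w y (Pi.single i (1:ℝ)) := fun i =>
    ((hbi i).continuous.mul (hDw i)).integrable_of_hasCompactSupport (hcsw i).mul_left
  have I3 : ∀ i, Integrable fun y => b y i * w y := fun i =>
    ((hbi i).continuous.mul hw.continuous).integrable_of_hasCompactSupport hws.mul_left
  have : ∀ y, fderiv ℝ w y (b y) = ∑ i, b y i * fderiv ℝ w y (Pi.single i (1:ℝ)) := by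
    intro y
    rw [fderiv_eq_gradv, dotProduct_comm]; rfl
  simp_rw [this]
  rw [integral_finsetSum _ fun i _ => I2 i]
  have : ∀ i, ∫ y, b y i * fderiv ℝ w y (Pi.single i (1:ℝ)) =
      - ∫ y, fderiv ℝ (fun z => b z i) y (Pi.single i (1:ℝ)) * w y := fun i =>
    integral_mul_fderiv_eq_neg_fderiv_mul_of_integrable (I1 i) (I2 i) (I3 i)
      (fun x _ => (hbi i).differentiable (by norm_num) x)
      (fun x _ => hw.differentiable (by norm_num) x)
  simp_rw [this]
  rw [Finset.sum_neg_distrib, ← integral_finsetSum _ fun i _ => I1 i]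
  simp_rw [← Finset.sum_mul, hdivb]
  simp

theorem gradv_transport {b : (Fin m → ℝ) → (Fin m → ℝ)} (hb : ContDiff ℝ 1 b)
    {u : (Fin m → ℝ) → ℝ} (hu : ContDiff ℝ 2 u) (y : Fin m → ℝ) :
    gradv (fun z => fderiv ℝ u z (b z)) y =
      (fun i => fderiv ℝ (fun z => gradv u z i) y (b y)) + (jacm b y)ᵀ *ᵥ gradv u y := by
  have hdb := hb.differentiable (by norm_num) y
  have h1 : HasFDerivAt (fderiv ℝ u) (fderiv ℝ (fderiv ℝ u) y) y :=
    ((hu.fderiv_right (m := 1) (by norm_num)).differentiable (by norm_num) y).hasFDerivAt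
  have h2 := h1.clm_apply hdb.hasFDerivAt
  have hsym : IsSymmSndFDerivAt ℝ u y :=
    hu.contDiffAt.isSymmSndFDerivAt (by simp)
  ext i
  have h3 := h1.clm_apply (hasFDerivAt_const (Pi.single i (1:ℝ)) y)
  have e1 : fderiv ℝ (fun z => gradv u z i) y = _ := h3.fderiv
  rw [gradv, h2.fderiv, Pi.add_apply, e1]
  have e2 : fderiv ℝ u y (fderiv ℝ b y (Pi.single i 1)) = ((jacm b y)ᵀ *ᵥ gradv u y) i := by
    rw [fderiv_eq_gradv, dotProduct_comm]
    simp [Matrix.mulVec, dotProduct, jacm_apply hdb]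
  rw [← e2]
  have := hsym.eq (b y) (Pi.single i 1)
  simp [this, add_comm]

theorem continuous_of_entries {B : (Fin m → ℝ) → Matrix (Fin m) (Fin m) ℝ}
    (h : ∀ i j, Continuous fun y => B y i j) : Continuous B :=
  continuous_pi fun i => continuous_pi fun j => h i j

theorem continuous_jacm {F : (Fin m → ℝ) → (Fin m → ℝ)} (hF : ContDiff ℝ 1 F) :
    Continuous (jacm F) :=
  continuous_of_entries fun i _ =>
    ((contDiff_pi.1 hF i).continuous_fderiv (by norm_num)).clm_apply continuous_const

/-- the bracket -/
noncomputable def brk (b : (Fin m → ℝ) → (Fin m → ℝ)) (A : (Fin m → ℝ) → Matrix (Fin m) (Fin m) ℝ)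
    (y : Fin m → ℝ) : Matrix (Fin m) (Fin m) ℝ :=
  (Matrix.of fun i j => fderiv ℝ (fun z => A z i j) y (b y)) - jacm b y * A y - A y * (jacm b y)ᵀ

theorem continuous_brk {b : (Fin m → ℝ) → (Fin m → ℝ)} (hb : ContDiff ℝ 1 b)
    {A : (Fin m → ℝ) → Matrix (Fin m) (Fin m) ℝ}
    (hA : ∀ i j, ContDiff ℝ 1 (fun y => A y i j)) : Continuous (brk b A) := by
  have hAc : Continuous A := continuous_of_entries fun i j => (hA i j).continuous
  have hJ := continuous_jacm hb
  refine ((continuous_of_entries fun i j => ?_).sub (hJ.matrix_mul hAc)).sub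
    (hAc.matrix_mul hJ.matrix_transpose)
  exact ((hA i j).continuous_fderiv (by norm_num)).clm_apply hb.continuous

theorem brk_symm {b : (Fin m → ℝ) → (Fin m → ℝ)}
    {A : (Fin m → ℝ) → Matrix (Fin m) (Fin m) ℝ}
    (hAsym : ∀ y, (A y)ᵀ = A y) (y : Fin m → ℝ) : (brk b A y)ᵀ = brk b A y := by
  have h : (Matrix.of fun i j => fderiv ℝ (fun z => A z i j) y (b y))ᵀ =
      (Matrix.of fun i j => fderiv ℝ (fun z => A z i j) y (b y)) := by
    ext i j
    have : (fun z => A z j i) = fun z => A z i j := by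
      ext z; exact congrFun (congrFun (hAsym z) i) j
    simp [this]
  simp only [brk, transpose_sub, h, transpose_mul, transpose_transpose, hAsym]
  abel

theorem pointwise_three {b : (Fin m → ℝ) → (Fin m → ℝ)} (hb : ContDiff ℝ 1 b)
    {A : (Fin m → ℝ) → Matrix (Fin m) (Fin m) ℝ}
    (hA : ∀ i j, ContDiff ℝ 1 (fun y => A y i j))
    {u v : (Fin m → ℝ) → ℝ} (hu : ContDiff ℝ 2 u) (hv : ContDiff ℝ 2 v) (y : Fin m → ℝ) :
    (A y *ᵥ gradv (fun z => fderiv ℝ u z (b z)) y) ⬝ᵥ gradv v y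
      + (A y *ᵥ gradv u y) ⬝ᵥ gradv (fun z => fderiv ℝ v z (b z)) y
      = fderiv ℝ (fun z => (A z *ᵥ gradv u z) ⬝ᵥ gradv v z) y (b y)
        - (brk b A y *ᵥ gradv u y) ⬝ᵥ gradv v y := by
  have dA : ∀ i j, HasFDerivAt (fun z => A z i j) (fderiv ℝ (fun z => A z i j) y) y := fun i j =>
    ((hA i j).differentiable (by norm_num) y).hasFDerivAt
  have du : ∀ i, HasFDerivAt (fun z => gradv u z i) (fderiv ℝ (fun z => gradv u z i) y) y := fun i =>
    ((contDiff_gradv (n := 1) hu i).differentiable (by norm_num) y).hasFDerivAt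
  have dv : ∀ i, HasFDerivAt (fun z => gradv v z i) (fderiv ℝ (fun z => gradv v z i) y) y := fun i =>
    ((contDiff_gradv (n := 1) hv i).differentiable (by norm_num) y).hasFDerivAt
  have dw : fderiv ℝ (fun z => (A z *ᵥ gradv u z) ⬝ᵥ gradv v z) y (b y) =
      ((Matrix.of fun i j => fderiv ℝ (fun z => A z i j) y (b y)) *ᵥ gradv u y) ⬝ᵥ gradv v y
      + (A y *ᵥ (fun i => fderiv ℝ (fun z => gradv u z i) y (b y))) ⬝ᵥ gradv v y
      + (A y *ᵥ gradv u y) ⬝ᵥ (fun i => fderiv ℝ (fun z => gradv v z i) y (b y)) := by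
    have := HasFDerivAt.fun_sum (u := Finset.univ) (fun i _ =>
      (HasFDerivAt.fun_sum (u := Finset.univ) (fun j _ => (dA i j).mul (du j))).mul (dv i))
    have e := this.fderiv
    simp only [Matrix.mulVec, dotProduct]
    erw [e]
    simp only [_root_.sum_apply, _root_.add_apply,
      _root_.smul_apply, smul_eq_mul, Matrix.of_apply, Pi.mul_apply,
      ← Finset.sum_add_distrib, Finset.mul_sum, Finset.sum_mul]
    refine Finset.sum_congr rfl fun i _ => ?_
    refine Finset.sum_congr rfl fun j _ => ?_
    ring
  rw [dw, gradv_transport hb hu, gradv_transport hb hv, brk]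
  have e : (A y *ᵥ gradv u y) ⬝ᵥ ((jacm b y)ᵀ *ᵥ gradv v y) =
     ((jacm b y * A y) *ᵥ gradv u y) ⬝ᵥ gradv v y := by
    rw [dotProduct_mulVec, vecMul_transpose, mulVec_mulVec]
  simp only [mulVec_add, add_dotProduct, dotProduct_add, sub_mulVec, sub_dotProduct, e, mulVec_mulVec]
  ring

theorem int_three {b : (Fin m → ℝ) → (Fin m → ℝ)} (hb : ContDiff ℝ 1 b)
    (hdivb : ∀ y, ∑ i, fderiv ℝ (fun z => b z i) y (Pi.single i (1:ℝ)) = 0)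
    {A : (Fin m → ℝ) → Matrix (Fin m) (Fin m) ℝ}
    (hA : ∀ i j, ContDiff ℝ 1 (fun y => A y i j)) (hAsym : ∀ y, (A y)ᵀ = A y)
    {u v : (Fin m → ℝ) → ℝ} (hu : ContDiff ℝ 2 u) (hus : HasCompactSupport u)
    (hv : ContDiff ℝ 2 v) (hvs : HasCompactSupport v) :
    (∫ y, (A y *ᵥ gradv (fun z => fderiv ℝ u z (b z)) y) ⬝ᵥ gradv v y)
      + (∫ y, (A y *ᵥ gradv u y) ⬝ᵥ gradv (fun z => fderiv ℝ v z (b z)) y)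
      = - ∫ y, (brk b A y *ᵥ gradv u y) ⬝ᵥ gradv v y := by
  have one_two : (1 : WithTop ℕ∞) ≤ 2 := by norm_num
  have hAc : Continuous A := continuous_of_entries fun i j => (hA i j).continuous
  have hbu : ContDiff ℝ 1 (fun z => fderiv ℝ u z (b z)) :=
    (hu.fderiv_right (m := 1) (by norm_num)).clm_apply hb
  have hbv : ContDiff ℝ 1 (fun z => fderiv ℝ v z (b z)) :=
    (hv.fderiv_right (m := 1) (by norm_num)).clm_apply hb
  have hu1 := hu.of_le one_two
  have hv1 := hv.of_le one_two
  have I1 := int_form hAc (continuous_gradv hbu) hv1 hvs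
  have I2 := int_form' hAc hAsym (continuous_gradv hbv) hu1 hus
  have I3 := int_form (continuous_brk hb hA) (continuous_gradv hu1) hv1 hvs
  have hw : ContDiff ℝ 1 (fun z => (A z *ᵥ gradv u z) ⬝ᵥ gradv v z) := by
    simp only [Matrix.mulVec, dotProduct]
    exact ContDiff.sum fun i _ => (ContDiff.sum fun j _ =>
      (hA i j).mul (contDiff_gradv (n := 1) hu j)).mul (contDiff_gradv (n := 1) hv i)
  have hws : HasCompactSupport (fun z => (A z *ᵥ gradv u z) ⬝ᵥ gradv v z) := hcs_form hvs _
  have I4 : Integrable fun y => fderiv ℝ (fun z => (A z *ᵥ gradv u z) ⬝ᵥ gradv v z) y (b y) := by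
    refine Continuous.integrable_of_hasCompactSupport
      ((hw.continuous_fderiv (by norm_num)).clm_apply hb.continuous) ((hws.fderiv ℝ).mono ?_)
    intro y hy
    contrapose! hy
    have : fderiv ℝ (fun z => (A z *ᵥ gradv u z) ⬝ᵥ gradv v z) y = 0 := by simpa using hy
    simp [this]
  rw [← integral_add I1 I2]
  simp_rw [pointwise_three hb hA hu hv]
  rw [integral_sub I4 I3, integral_transport hb hdivb hw hws, zero_sub]

end Test

section Flow
variable {m : ℕ}

theorem hasDerivAt_mat_mul {M N : ℝ → Matrix (Fin m) (Fin m) ℝ} {M' N' : Matrix (Fin m) (Fin m) ℝ}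
    {s : ℝ} (hM : ∀ i j, HasDerivAt (fun t => M t i j) (M' i j) s)
    (hN : ∀ i j, HasDerivAt (fun t => N t i j) (N' i j) s) (i j : Fin m) :
    HasDerivAt (fun t => (M t * N t) i j) ((M' * N s + M s * N') i j) s := by
  simp only [Matrix.add_apply, Matrix.mul_apply, ← Finset.sum_add_distrib]
  exact HasDerivAt.fun_sum fun k _ => (hM i k).mul (hN k j)

theorem bound_comm (L X : Matrix (Fin m) (Fin m) ℝ) (c : ℝ) (hc : ∑ i, ∑ k, |L i k| ≤ c) :
    ‖(fun i j => (L * X + X * Lᵀ) i j : Fin m → Fin m → ℝ)‖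
      ≤ (2 * c) * ‖(fun i j => X i j : Fin m → Fin m → ℝ)‖ := by
  set N := ‖(fun i j => X i j : Fin m → Fin m → ℝ)‖ with hN
  have hX : ∀ i j, |X i j| ≤ N := fun i j =>
    (norm_le_pi_norm (fun j => X i j) j).trans (norm_le_pi_norm (fun i j => X i j) i)
  have hN0 : 0 ≤ N := norm_nonneg _
  have hL : ∀ i, ∑ k, |L i k| ≤ c := fun i =>
    (Finset.single_le_sum (f := fun i => ∑ k, |L i k|)
      (fun i _ => Finset.sum_nonneg fun k _ => abs_nonneg _) (Finset.mem_univ i)).trans hc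
  have hc0 : 0 ≤ c := (Finset.sum_nonneg fun i _ => Finset.sum_nonneg fun k _ => abs_nonneg _).trans hc
  refine (pi_norm_le_iff_of_nonneg (by positivity)).2 fun i =>
    (pi_norm_le_iff_of_nonneg (by positivity)).2 fun j => ?_
  simp only [Matrix.add_apply, Matrix.mul_apply, Matrix.transpose_apply, Real.norm_eq_abs]
  have e1 : |∑ k, L i k * X k j| ≤ c * N := by
    refine (Finset.abs_sum_le_sum_abs _ _).trans ?_
    calc ∑ k, |L i k * X k j| ≤ ∑ k, |L i k| * N := by
          gcongr with k; rw [abs_mul]; gcongr; exact hX _ _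
      _ = (∑ k, |L i k|) * N := by rw [Finset.sum_mul]
      _ ≤ c * N := by gcongr; exact hL i
  have e2 : |∑ k, X i k * L j k| ≤ c * N := by
    refine (Finset.abs_sum_le_sum_abs _ _).trans ?_
    calc ∑ k, |X i k * L j k| ≤ ∑ k, |L j k| * N := by
          gcongr with k; rw [abs_mul, mul_comm]; gcongr; exact hX _ _
      _ = (∑ k, |L j k|) * N := by rw [Finset.sum_mul]
      _ ≤ c * N := by gcongr; exact hL j
  refine (abs_add_le _ _).trans ?_
  linarith

variable {b : (Fin m → ℝ) → (Fin m → ℝ)} {C : ℝ} {Y : ℝ → (Fin m → ℝ) → (Fin m → ℝ)}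
  {A : (Fin m → ℝ) → Matrix (Fin m) (Fin m) ℝ}

theorem hasDerivAt_jacm (hb : ContDiff ℝ 1 b)
    (hC : 0 < C) (hgrow : ∀ y, ‖b y‖ ≤ C * (1 + ‖y‖))
    (hY0 : ∀ y, Y 0 y = y)
    (hYd : ∀ (s : ℝ) (y : Fin m → ℝ), HasDerivAt (fun t => Y t y) (b (Y s y)) s)
    (hYs : ∀ s : ℝ, ContDiff ℝ 1 (Y s)) (y : Fin m → ℝ) (s : ℝ) (i j : Fin m) :
    HasDerivAt (fun t => jacm (Y t) y i j) ((jacm b (Y s y) * jacm (Y s) y) i j) s := by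
  have h := hasDerivAt_pi.1 (aux_var hb hC hgrow hY0 hYd hYs y (Pi.single j 1) s) i
  have hd : ∀ t, DifferentiableAt ℝ (Y t) y := fun t => (hYs t).differentiable (by norm_num) y
  have hdb := hb.differentiable (by norm_num) (Y s y)
  simp_rw [fun t => jacm_apply (hd t) i j]
  have e : fderiv ℝ (fun z => b z i) (Y s y) (fderiv ℝ (Y s) y (Pi.single j 1)) =
      fderiv ℝ b (Y s y) (fderiv ℝ (Y s) y (Pi.single j 1)) i := by
    have h := (hasFDerivAt_pi'.1 hdb.hasFDerivAt) i
    rw [h.fderiv]; rfl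
  have e2 : (jacm b (Y s y) * jacm (Y s) y) i j =
      fderiv ℝ b (Y s y) (fderiv ℝ (Y s) y (Pi.single j 1)) i := by
    rw [← e, fderiv_eq_gradv, Matrix.mul_apply]
    simp only [dotProduct, jacm_apply (hd s)]
    rfl
  rw [e2]
  exact h

theorem hasDerivAt_Q (hb : ContDiff ℝ 1 b)
    (hC : 0 < C) (hgrow : ∀ y, ‖b y‖ ≤ C * (1 + ‖y‖))
    (hY0 : ∀ y, Y 0 y = y)
    (hYd : ∀ (s : ℝ) (y : Fin m → ℝ), HasDerivAt (fun t => Y t y) (b (Y s y)) s)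
    (hYs : ∀ s : ℝ, ContDiff ℝ 1 (Y s))
    (hA : ∀ i j, ContDiff ℝ 1 (fun y => A y i j)) (y : Fin m → ℝ) (s : ℝ) (i j : Fin m) :
    HasDerivAt (fun t => (jacm (Y t) y * A y * (jacm (Y t) y)ᵀ - A (Y t y)) i j)
      ((jacm b (Y s y) * (jacm (Y s) y * A y * (jacm (Y s) y)ᵀ - A (Y s y))
        + (jacm (Y s) y * A y * (jacm (Y s) y)ᵀ - A (Y s y)) * (jacm b (Y s y))ᵀ
        - brk b A (Y s y)) i j) s := by
  have hM := hasDerivAt_jacm hb hC hgrow hY0 hYd hYs y s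
  have hMA := hasDerivAt_mat_mul (N := fun _ => A y) (N' := 0) hM (fun i j => hasDerivAt_const _ _)
  have hMAM := hasDerivAt_mat_mul (N := fun t => (jacm (Y t) y)ᵀ)
    (N' := (jacm b (Y s y) * jacm (Y s) y)ᵀ) hMA (fun i j => hM j i) i j
  have hAY : HasDerivAt (fun t => A (Y t y) i j) (fderiv ℝ (fun z => A z i j) (Y s y) (b (Y s y))) s := by
    have hf : HasFDerivAt (fun z => A z i j) (fderiv ℝ (fun z => A z i j) (Y s y)) (Y s y) :=
      ((hA i j).differentiable (by norm_num) (Y s y)).hasFDerivAt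
    exact HasFDerivAt.comp_hasDerivAt (f := fun t => Y t y) s hf (hYd s y)
  have hfin := hMAM.sub hAY
  refine HasDerivAt.congr_deriv hfin ?_
  symm
  have : fderiv ℝ (fun z => A z i j) (Y s y) (b (Y s y)) =
    (Matrix.of fun i j => fderiv ℝ (fun z => A z i j) (Y s y) (b (Y s y))) i j := rfl
  rw [this, ← Matrix.sub_apply]
  rw [brk, transpose_mul]
  simp only [Matrix.mul_sub, Matrix.sub_mul, Matrix.mul_zero, add_zero, Matrix.mul_assoc,
    Matrix.add_mul, Matrix.add_apply, Matrix.sub_apply]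
  ring

theorem jacm_zero (hY0 : ∀ y, Y 0 y = y) (y : Fin m → ℝ) : jacm (Y 0) y = 1 := by
  have : Y 0 = id := funext hY0
  ext i j
  rw [this, jacm_apply differentiableAt_id]
  simp [Matrix.one_apply, Pi.single_apply]

theorem Q_zero_of_brk (hb : ContDiff ℝ 1 b)
    (hC : 0 < C) (hgrow : ∀ y, ‖b y‖ ≤ C * (1 + ‖y‖))
    (hY0 : ∀ y, Y 0 y = y)
    (hYd : ∀ (s : ℝ) (y : Fin m → ℝ), HasDerivAt (fun t => Y t y) (b (Y s y)) s)
    (hYs : ∀ s : ℝ, ContDiff ℝ 1 (Y s))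
    (hA : ∀ i j, ContDiff ℝ 1 (fun y => A y i j)) (h : ∀ y, brk b A y = 0)
    (y : Fin m → ℝ) (s : ℝ) :
    jacm (Y s) y * A y * (jacm (Y s) y)ᵀ = A (Y s y) := by
  have hYc : Continuous fun t => Y t y :=
    continuous_iff_continuousAt.2 fun t => (hYd t y).continuousAt
  have := aux_zero
    (f := fun t => (fun i j => (jacm (Y t) y * A y * (jacm (Y t) y)ᵀ - A (Y t y)) i j :
      Fin m → Fin m → ℝ))
    (f' := fun s => (fun i j => (jacm b (Y s y) * (jacm (Y s) y * A y * (jacm (Y s) y)ᵀ - A (Y s y))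
        + (jacm (Y s) y * A y * (jacm (Y s) y)ᵀ - A (Y s y)) * (jacm b (Y s y))ᵀ) i j))
    (fun t => hasDerivAt_pi.2 fun i => hasDerivAt_pi.2 fun j => by
      have := hasDerivAt_Q hb hC hgrow hY0 hYd hYs hA y t i j
      rwa [h, sub_zero] at this)
    (by ext i j; simp [jacm_zero hY0, hY0])
    (fun T => by
      have hc : Continuous fun t => ∑ i, ∑ k, |jacm b (Y t y) i k| :=
        continuous_finsetSum _ fun i _ => continuous_finsetSum _ fun k _ =>
          (((continuous_jacm hb).matrix_elem i k).comp hYc).abs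
      obtain ⟨c, hc⟩ := (isCompact_Icc (a := -T) (b := T)).exists_bound_of_continuousOn hc.continuousOn
      exact ⟨2 * c, fun t ht => bound_comm _ _ c ((le_abs_self _).trans (hc t (abs_le.1 ht)))⟩) s
  rw [← sub_eq_zero]
  ext i j
  exact congrFun (congrFun this i) j

theorem brk_zero_of_Q (hb : ContDiff ℝ 1 b)
    (hC : 0 < C) (hgrow : ∀ y, ‖b y‖ ≤ C * (1 + ‖y‖))
    (hY0 : ∀ y, Y 0 y = y)
    (hYd : ∀ (s : ℝ) (y : Fin m → ℝ), HasDerivAt (fun t => Y t y) (b (Y s y)) s)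
    (hYs : ∀ s : ℝ, ContDiff ℝ 1 (Y s))
    (hA : ∀ i j, ContDiff ℝ 1 (fun y => A y i j))
    (h : ∀ y s, jacm (Y s) y * A y * (jacm (Y s) y)ᵀ = A (Y s y)) (y : Fin m → ℝ) :
    brk b A y = 0 := by
  ext i j
  have := hasDerivAt_Q hb hC hgrow hY0 hYd hYs hA y 0 i j
  simp only [h, sub_self, hY0, Matrix.mul_zero, Matrix.zero_mul, add_zero, zero_sub] at this
  have h0 := this.unique (hasDerivAt_const (0:ℝ) (0:ℝ))
  simpa using h0

theorem form_pull (A M : Matrix (Fin m) (Fin m) ℝ) (p q : Fin m → ℝ) :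
    (A *ᵥ (Mᵀ *ᵥ p)) ⬝ᵥ (Mᵀ *ᵥ q) = ((M * A * Mᵀ) *ᵥ p) ⬝ᵥ q := by
  rw [dotProduct_mulVec, vecMul_transpose, mulVec_mulVec, mulVec_mulVec, Matrix.mul_assoc]

theorem integral_mp {φ : (Fin m → ℝ) → (Fin m → ℝ)} (h : MeasurePreserving φ volume volume)
    {f : (Fin m → ℝ) → ℝ} (hf : Continuous f) : ∫ y, f (φ y) = ∫ y, f y := by
  have := integral_map (μ := volume) (φ := φ) h.measurable.aemeasurable (f := f)
    hf.aestronglyMeasurable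
  rw [h.map_eq] at this
  exact this.symm

theorem two_of_Q (hYs : ∀ s : ℝ, ContDiff ℝ 1 (Y s))
    (hYmp : ∀ s : ℝ, MeasurePreserving (Y s) (volume : Measure (Fin m → ℝ)) volume)
    (hA : ∀ i j, ContDiff ℝ 1 (fun y => A y i j))
    (h : ∀ y s, jacm (Y s) y * A y * (jacm (Y s) y)ᵀ = A (Y s y))
    (s : ℝ) (u v : (Fin m → ℝ) → ℝ) (hu : ContDiff ℝ 1 u) (hv : ContDiff ℝ 1 v) :
    ∫ y, (A y *ᵥ gradv (fun z => u (Y s z)) y) ⬝ᵥ gradv (fun z => v (Y s z)) y =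
      ∫ y, (A y *ᵥ gradv u y) ⬝ᵥ gradv v y := by
  have hAc : Continuous A := continuous_of_entries fun i j => (hA i j).continuous
  rw [← integral_mp (hYmp s) ((hAc.matrix_mulVec (continuous_gradv hu)).dotProduct
    (continuous_gradv hv))]
  congr 1
  ext1 y
  have hd := (hYs s).differentiable (by norm_num) y
  rw [gradv_comp (hu.differentiable (by norm_num) _) hd,
    gradv_comp (hv.differentiable (by norm_num) _) hd, form_pull, h]

theorem Q_of_two (hb : ContDiff ℝ 1 b)
    (hY0 : ∀ y, Y 0 y = y)
    (hYd : ∀ (s : ℝ) (y : Fin m → ℝ), HasDerivAt (fun t => Y t y) (b (Y s y)) s)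
    (hYs : ∀ s : ℝ, ContDiff ℝ 1 (Y s))
    (hYmp : ∀ s : ℝ, MeasurePreserving (Y s) (volume : Measure (Fin m → ℝ)) volume)
    (hA : ∀ i j, ContDiff ℝ 1 (fun y => A y i j)) (hAsym : ∀ y, (A y)ᵀ = A y) (s : ℝ)
    (h : ∀ (u v : (Fin m → ℝ) → ℝ), ContDiff ℝ 1 u → HasCompactSupport u → ContDiff ℝ 1 v →
      HasCompactSupport v →
      ∫ y, (A y *ᵥ gradv (fun z => u (Y s z)) y) ⬝ᵥ gradv (fun z => v (Y s z)) y =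
      ∫ y, (A y *ᵥ gradv u y) ⬝ᵥ gradv v y) (y : Fin m → ℝ) :
    jacm (Y s) y * A y * (jacm (Y s) y)ᵀ = A (Y s y) := by
  have hAc : Continuous A := continuous_of_entries fun i j => (hA i j).continuous
  have hJ := continuous_jacm (hYs s)
  have hYi : ∀ z, Y s (Y (-s) z) = z := fun z => by
    simpa using aux_inv hb hY0 hYd (-s) z
  let G : (Fin m → ℝ) → Matrix (Fin m) (Fin m) ℝ := fun y =>
    jacm (Y s) y * A y * (jacm (Y s) y)ᵀ
  have hG : Continuous G := (hJ.matrix_mul hAc).matrix_mul hJ.matrix_transpose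
  have hGY : Continuous fun z => G (Y (-s) z) := hG.comp (hYs (-s)).continuous
  have key := zero_of_forms (B := fun z => G (Y (-s) z) - A z) (hGY.sub hAc)
    (fun z => by simp [G, transpose_mul, hAsym, Matrix.mul_assoc])
    (fun u v hu hus hv hvs => by
      have one_two : (1 : WithTop ℕ∞) ≤ 2 := by norm_num
      have hu1 := hu.of_le one_two
      have hv1 := hv.of_le one_two
      have h1 := h u v hu1 hus hv1 hvs
      have e : ∀ y, (A y *ᵥ gradv (fun z => u (Y s z)) y) ⬝ᵥ gradv (fun z => v (Y s z)) y =
          (G y *ᵥ gradv u (Y s y)) ⬝ᵥ gradv v (Y s y) := by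
        intro y
        have hd := (hYs s).differentiable (by norm_num) y
        rw [gradv_comp (hu1.differentiable (by norm_num) _) hd,
          gradv_comp (hv1.differentiable (by norm_num) _) hd, form_pull]
      simp_rw [e] at h1
      have hc : Continuous fun y => (G y *ᵥ gradv u (Y s y)) ⬝ᵥ gradv v (Y s y) :=
        (hG.matrix_mulVec ((continuous_gradv hu1).comp (hYs s).continuous)).dotProduct
          ((continuous_gradv hv1).comp (hYs s).continuous)
      rw [← integral_mp (hYmp (-s)) hc] at h1
      simp only [hYi] at h1
      simp_rw [sub_mulVec, sub_dotProduct]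
      rw [integral_sub (int_form hGY (continuous_gradv hu1) hv1 hvs)
        (int_form hAc (continuous_gradv hu1) hv1 hvs), h1, sub_self]) (Y s y)
  simp only [aux_inv hb hY0 hYd s y] at key
  exact sub_eq_zero.1 key

end Flow

/-- Let `b` be a `C¹` divergence-free vector field with linear growth and
measure-preserving flow `Y`, and let `A` be a `C¹` field of symmetric matrices.  The
following are equivalent:
(1) `[b,A] = (b·∇_y)A − (∂_y b) A − A ᵗ(∂_y b) = 0` identically;
(2) for every `s ∈ ℝ` and `u, v ∈ C¹_c`,
    `∫ A ∇(u∘Y(s;·)) · ∇(v∘Y(s;·)) dy = ∫ A ∇u · ∇v dy`;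
(3) for all `u, v ∈ C²_c`,
    `∫ A ∇(b·∇u) · ∇v dy + ∫ A ∇u · ∇(b·∇v) dy = 0`. -/
theorem matrix_field_involution_weak_characterizations
    (m : ℕ) (hm : 1 ≤ m)
    (b : (Fin m → ℝ) → (Fin m → ℝ)) (hb : ContDiff ℝ 1 b)
    (C : ℝ) (hC : 0 < C) (hgrow : ∀ y, ‖b y‖ ≤ C * (1 + ‖y‖))
    (hdivb : ∀ y, ∑ i, fderiv ℝ (fun z => b z i) y (Pi.single i (1:ℝ)) = 0)
    (Y : ℝ → (Fin m → ℝ) → (Fin m → ℝ))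
    (hY0 : ∀ y, Y 0 y = y)
    (hYd : ∀ (s : ℝ) (y : Fin m → ℝ), HasDerivAt (fun t => Y t y) (b (Y s y)) s)
    (hYs : ∀ s : ℝ, ContDiff ℝ 1 (Y s))
    (hYmp : ∀ s : ℝ, MeasurePreserving (Y s) (volume : Measure (Fin m → ℝ)) volume)
    (A : (Fin m → ℝ) → Matrix (Fin m) (Fin m) ℝ)
    (hA : ∀ i j, ContDiff ℝ 1 (fun y => A y i j))
    (hAsym : ∀ y, (A y)ᵀ = A y) :
    ((∀ y, (Matrix.of fun i j => fderiv ℝ (fun z => A z i j) y (b y))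
        - (Matrix.of fun i j => fderiv ℝ (fun z => b z i) y (Pi.single j (1:ℝ))) * A y
        - A y * ((Matrix.of fun i j => fderiv ℝ (fun z => b z i) y (Pi.single j (1:ℝ)))ᵀ)
        = 0) ↔
      (∀ (s : ℝ) (u v : (Fin m → ℝ) → ℝ),
        ContDiff ℝ 1 u → HasCompactSupport u → ContDiff ℝ 1 v → HasCompactSupport v →
        ∫ y, (A y *ᵥ (fun i => fderiv ℝ (fun z => u (Y s z)) y (Pi.single i (1:ℝ)))) ⬝ᵥ
            (fun i => fderiv ℝ (fun z => v (Y s z)) y (Pi.single i (1:ℝ)))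
            ∂(volume : Measure (Fin m → ℝ))
          = ∫ y, (A y *ᵥ (fun i => fderiv ℝ u y (Pi.single i (1:ℝ)))) ⬝ᵥ
              (fun i => fderiv ℝ v y (Pi.single i (1:ℝ)))
              ∂(volume : Measure (Fin m → ℝ)))) ∧
    ((∀ y, (Matrix.of fun i j => fderiv ℝ (fun z => A z i j) y (b y))
        - (Matrix.of fun i j => fderiv ℝ (fun z => b z i) y (Pi.single j (1:ℝ))) * A y
        - A y * ((Matrix.of fun i j => fderiv ℝ (fun z => b z i) y (Pi.single j (1:ℝ)))ᵀ)
        = 0) ↔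
      (∀ u v : (Fin m → ℝ) → ℝ,
        ContDiff ℝ 2 u → HasCompactSupport u → ContDiff ℝ 2 v → HasCompactSupport v →
        (∫ y, (A y *ᵥ (fun i => fderiv ℝ (fun z => fderiv ℝ u z (b z)) y
              (Pi.single i (1:ℝ)))) ⬝ᵥ (fun i => fderiv ℝ v y (Pi.single i (1:ℝ)))
            ∂(volume : Measure (Fin m → ℝ)))
          + (∫ y, (A y *ᵥ (fun i => fderiv ℝ u y (Pi.single i (1:ℝ)))) ⬝ᵥ
              (fun i => fderiv ℝ (fun z => fderiv ℝ v z (b z)) y (Pi.single i (1:ℝ)))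
              ∂(volume : Measure (Fin m → ℝ))) = 0)) := by
  have key1 : (∀ y, brk b A y = 0) ↔ (∀ (s : ℝ) (u v : (Fin m → ℝ) → ℝ),
        ContDiff ℝ 1 u → HasCompactSupport u → ContDiff ℝ 1 v → HasCompactSupport v →
        ∫ y, (A y *ᵥ gradv (fun z => u (Y s z)) y) ⬝ᵥ gradv (fun z => v (Y s z)) y =
          ∫ y, (A y *ᵥ gradv u y) ⬝ᵥ gradv v y) := by
    constructor
    · intro h s u v hu _ hv _
      exact two_of_Q hYs hYmp hA (Q_zero_of_brk hb hC hgrow hY0 hYd hYs hA h) s u v hu hv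
    · intro h
      exact brk_zero_of_Q hb hC hgrow hY0 hYd hYs hA fun y s =>
        Q_of_two hb hY0 hYd hYs hYmp hA hAsym s (h s) y
  have key2 : (∀ y, brk b A y = 0) ↔ (∀ u v : (Fin m → ℝ) → ℝ,
        ContDiff ℝ 2 u → HasCompactSupport u → ContDiff ℝ 2 v → HasCompactSupport v →
        (∫ y, (A y *ᵥ gradv (fun z => fderiv ℝ u z (b z)) y) ⬝ᵥ gradv v y)
      + (∫ y, (A y *ᵥ gradv u y) ⬝ᵥ gradv (fun z => fderiv ℝ v z (b z)) y) = 0) := by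
    constructor
    · intro h u v hu hus hv hvs
      rw [int_three hb hdivb hA hAsym hu hus hv hvs]
      simp [h]
    · intro h
      refine zero_of_forms (continuous_brk hb hA) (brk_symm hAsym) fun u v hu hus hv hvs => ?_
      have := h u v hu hus hv hvs
      rw [int_three hb hdivb hA hAsym hu hus hv hvs] at this
      linarith
  exact ⟨key1, key2⟩
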